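/- arXiv:1810.09094 — 2 statements merged into one kernel-verified Lean document; each statement's English description precedes it below -/
import Mathlib

section
/- Let ν' := ν_0^α be the monomial valuation on k[x,y,z,t] at the origin with weights α = (α0,α1,α2,α3), where αi < 0 for all i. Then for all R1, R2, R3, R4 ∈ k[x,y,z,t] one has ν'(Jac(R1,R2,R3,R4)) ≥ ν'(R1) + ν'(R2) + ν'(R3) + ν'(R4) − ν'(xyzt), where ν'(xyzt) = α0 + α1 + α2 + α3 (with the convention ν'(0) = +∞). -/
noncomputable section

open MvPolynomial

/-- The polynomial `q = xt - yz` in `k[x,y,z,t]` (variables `x,y,z,t` are `X 0, X 1, X 2, X 3`). -/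
def qpoly (k : Type) [Field k] : MvPolynomial (Fin 4) k :=
  X 0 * X 3 - X 1 * X 2

/-- The coordinate ring `k[Q] = k[x,y,z,t]/(xt - yz - 1)` of the affine quadric threefold. -/
abbrev QuadRing (k : Type) [Field k] : Type :=
  MvPolynomial (Fin 4) k ⧸ Ideal.span {qpoly k - 1}

/-- The canonical projection `π : k[x,y,z,t] → k[Q]`. -/
def qmk (k : Type) [Field k] : MvPolynomial (Fin 4) k →+* QuadRing k :=
  Ideal.Quotient.mk (Ideal.span {qpoly k - 1})

/-- A valuation on a commutative `k`-algebra `A`, with values in `ℝ ∪ {+∞}`: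
`ν⁻¹({+∞}) = {0}`, `ν(a) = 0` for `a ∈ k*`, `ν(fg) = ν f + ν g`, and
`ν(f + g) ≥ min (ν f) (ν g)`. -/
def IsValuation (k : Type) [Field k] (A : Type) [CommRing A] [Algebra k A]
    (ν : A → WithTop ℝ) : Prop :=
  (∀ f : A, ν f = ⊤ ↔ f = 0) ∧
  (∀ a : k, a ≠ 0 → ν (algebraMap k A a) = 0) ∧
  (∀ f g : A, ν (f * g) = ν f + ν g) ∧
  (∀ f g : A, min (ν f) (ν g) ≤ ν (f + g))

/-- The monomial valuation `ν_p^α` on `k[x,y,z,t]` at the point `p` with weights `α`: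
the minimum of `⟨I, α⟩` over the exponents `I` appearing in the expansion of `R` in the
shifted variables `x - p₀, y - p₁, z - p₂, t - p₃` (and `+∞` on the zero polynomial). -/
def mvalP (k : Type) [Field k] (p : Fin 4 → k) (α : Fin 4 → ℝ)
    (R : MvPolynomial (Fin 4) k) : WithTop ℝ :=
  (MvPolynomial.aeval (fun i => X i + C (p i)) R : MvPolynomial (Fin 4) k).support.inf
    fun I => ((∑ i, α i * (I i : ℝ) : ℝ) : WithTop ℝ)

/-- The monomial valuation `ν_0^α` on `k[x,y,z,t]` at the origin with weights `α`. -/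
def mvalO (k : Type) [Field k] (α : Fin 4 → ℝ)
    (R : MvPolynomial (Fin 4) k) : WithTop ℝ :=
  R.support.inf fun I => ((∑ i, α i * (I i : ℝ) : ℝ) : WithTop ℝ)

/-- The map `ν : k[Q] → ℝ ∪ {+∞}` given by `ν(f) = sup {ν_p^α(R) : π R = f}`. -/
def nuSup (k : Type) [Field k] (p : Fin 4 → k) (α : Fin 4 → ℝ)
    (f : QuadRing k) : WithTop ℝ :=
  sSup {v : WithTop ℝ | ∃ R : MvPolynomial (Fin 4) k, qmk k R = f ∧ mvalP k p α R = v}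

/-- The set `𝒱₀` of valuations on `k[Q]` obtained from monomial valuations at points
`p ∈ k⁴` with weights `α ∈ (ℝ^{<0})⁴` satisfying `α₀ + α₃ = α₁ + α₂`. -/
def V0 (k : Type) [Field k] : Set (QuadRing k → WithTop ℝ) :=
  {ν | ∃ (p : Fin 4 → k) (α : Fin 4 → ℝ),
      (∀ i, α i < 0) ∧ α 0 + α 3 = α 1 + α 2 ∧ ν = nuSup k p α}

/-- The Jacobian determinant `Jac(R₁,R₂,R₃,R₄)` of four polynomials in `k[x,y,z,t]`. -/
def jac (k : Type) [Field k] (R : Fin 4 → MvPolynomial (Fin 4) k) :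
    MvPolynomial (Fin 4) k :=
  (Matrix.of fun i j : Fin 4 => MvPolynomial.pderiv j (R i)).det

/-- The monomial valuation on `k[X,Y]` with weights `w = (w₁, w₂)`. -/
def mval2 (k : Type) [Field k] (w : Fin 2 → ℝ)
    (R : MvPolynomial (Fin 2) k) : WithTop ℝ :=
  R.support.inf fun I => ((∑ i, w i * (I i : ℝ) : ℝ) : WithTop ℝ)

open Classical in
/-- The `(w₁,w₂)`-leading part of `R ∈ k[X,Y]`: the sum of the terms of `R` whose
weighted degree realizes the monomial valuation of `R` with weights `w`. -/
def leadPart2 (k : Type) [Field k] (w : Fin 2 → ℝ) (R : MvPolynomial (Fin 2) k) :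
    MvPolynomial (Fin 2) k :=
  ∑ I ∈ R.support.filter
      (fun I => ((∑ i, w i * (I i : ℝ) : ℝ) : WithTop ℝ) = mval2 k w R),
    monomial I (R.coeff I)

open Classical in
/-- The `α`-leading part `R^w` of `R ∈ k[x,y,z,t]` (with respect to the monomial
valuation at the origin with weights `α`). -/
def leadPart4 (k : Type) [Field k] (α : Fin 4 → ℝ) (R : MvPolynomial (Fin 4) k) :
    MvPolynomial (Fin 4) k :=
  ∑ I ∈ R.support.filter
      (fun I => ((∑ i, α i * (I i : ℝ) : ℝ) : WithTop ℝ) = mvalO k α R),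
    monomial I (R.coeff I)

/-- `(f₁, f₂)` is a component of an automorphism of `Q`: there is a `k`-algebra
automorphism `σ` of `k[Q]` with `σ x = f₁` and `σ y = f₂`. -/
def IsComponent (k : Type) [Field k] (f1 f2 : QuadRing k) : Prop :=
  ∃ σ : QuadRing k ≃ₐ[k] QuadRing k, σ (qmk k (X 0)) = f1 ∧ σ (qmk k (X 1)) = f2

/-- `(f₁, f₂)` is critically resonant with respect to `ν`. -/
def CriticallyResonant (k : Type) [Field k] (ν : QuadRing k → WithTop ℝ)
    (f1 f2 : QuadRing k) : Prop :=
  (∃ (m : ℕ) (lam : k), 1 ≤ m ∧ lam ≠ 0 ∧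
      ν f1 < ν (f1 - algebraMap k (QuadRing k) lam * f2 ^ m) ∧ ν f1 = m • ν f2) ∨
  (∃ (m : ℕ) (lam : k), 1 ≤ m ∧ lam ≠ 0 ∧
      ν f2 < ν (f2 - algebraMap k (QuadRing k) lam * f1 ^ m) ∧ ν f2 = m • ν f1)

theorem coe_le_mvalO_iff {k : Type} [Field k] {α : Fin 4 → ℝ} {R : MvPolynomial (Fin 4) k}
    {r : ℝ} : (r : WithTop ℝ) ≤ mvalO k α R ↔ ∀ I, coeff I R ≠ 0 → r ≤ ∑ i, α i * (I i : ℝ) := by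
  simp only [mvalO, Finset.le_inf_iff, WithTop.coe_le_coe, mem_support_iff]

theorem mvalO_zero {k : Type} [Field k] {α : Fin 4 → ℝ} : mvalO k α 0 = ⊤ := by
  simp [mvalO]

theorem exists_mvalO_eq_coe {k : Type} [Field k] (α : Fin 4 → ℝ) {R : MvPolynomial (Fin 4) k}
    (hR : R ≠ 0) : ∃ r : ℝ, mvalO k α R = r := by
  obtain ⟨I, -, hI⟩ := Finset.exists_mem_eq_inf R.support (support_nonempty.mpr hR)
    fun I => ((∑ i, α i * (I i : ℝ) : ℝ) : WithTop ℝ)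
  exact ⟨_, hI⟩

theorem coe_le_mvalO_mul {k : Type} [Field k] {α : Fin 4 → ℝ} {R S : MvPolynomial (Fin 4) k}
    {r s : ℝ} (hR : (r : WithTop ℝ) ≤ mvalO k α R) (hS : (s : WithTop ℝ) ≤ mvalO k α S) :
    ((r + s : ℝ) : WithTop ℝ) ≤ mvalO k α (R * S) := by
  classical
  rw [coe_le_mvalO_iff] at *
  intro I hI
  rw [coeff_mul] at hI
  obtain ⟨⟨a, b⟩, hab, hne⟩ := Finset.exists_ne_zero_of_sum_ne_zero hI
  rw [Finset.HasAntidiagonal.mem_antidiagonal] at hab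
  simp only at hab hne
  subst hab
  have h₁ := hR a (left_ne_zero_of_mul hne)
  have h₂ := hS b (right_ne_zero_of_mul hne)
  simp only [Finsupp.add_apply, Nat.cast_add, mul_add, Finset.sum_add_distrib]
  linarith

theorem coe_le_mvalO_prod {k : Type} [Field k] {α : Fin 4 → ℝ} {ι : Type} (s : Finset ι)
    {f : ι → MvPolynomial (Fin 4) k} {r : ι → ℝ}
    (h : ∀ i ∈ s, (r i : WithTop ℝ) ≤ mvalO k α (f i)) :
    ((∑ i ∈ s, r i : ℝ) : WithTop ℝ) ≤ mvalO k α (∏ i ∈ s, f i) := by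
  classical
  induction s using Finset.induction_on with
  | empty =>
    rw [coe_le_mvalO_iff]
    intro I hI
    have : I = 0 := by
      by_contra hne
      simp [coeff_one, Ne.symm hne] at hI
    simp [this]
  | insert a s ha ih =>
    rw [Finset.sum_insert ha, Finset.prod_insert ha]
    exact coe_le_mvalO_mul (h a (Finset.mem_insert_self a s))
      (ih fun i hi => h i (Finset.mem_insert_of_mem hi))

theorem coe_le_mvalO_pderiv {k : Type} [Field k] {α : Fin 4 → ℝ} {R : MvPolynomial (Fin 4) k}
    {r : ℝ} (j : Fin 4) (h : (r : WithTop ℝ) ≤ mvalO k α R) :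
    ((r - α j : ℝ) : WithTop ℝ) ≤ mvalO k α (pderiv j R) := by
  rw [coe_le_mvalO_iff] at *
  intro I hI
  rw [coeff_pderiv] at hI
  have h₁ := h _ (left_ne_zero_of_mul hI)
  simp only [Finsupp.add_apply, Nat.cast_add, mul_add, Finset.sum_add_distrib,
    Finsupp.single_apply] at h₁
  simp at h₁
  linarith

theorem coe_le_mvalO_det {k : Type} [Field k] {α : Fin 4 → ℝ}
    {M : Matrix (Fin 4) (Fin 4) (MvPolynomial (Fin 4) k)} {r c : Fin 4 → ℝ}
    (h : ∀ i j, ((r i - c j : ℝ) : WithTop ℝ) ≤ mvalO k α (M i j)) :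
    ((∑ i, r i - ∑ j, c j : ℝ) : WithTop ℝ) ≤ mvalO k α M.det := by
  rw [coe_le_mvalO_iff]
  intro I hI
  rw [← Matrix.det_transpose, Matrix.det_apply, coeff_sum] at hI
  obtain ⟨σ, -, hσ⟩ := Finset.exists_ne_zero_of_sum_ne_zero hI
  have hprod : coeff I (∏ i, M i (σ i)) ≠ 0 := by
    intro h0
    rcases Int.units_eq_one_or (Equiv.Perm.sign σ) with hs | hs <;>
      simp [hs, Matrix.transpose_apply, h0] at hσ
  have hle := coe_le_mvalO_iff.mp
    (coe_le_mvalO_prod Finset.univ fun i _ => h i (σ i)) I hprod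
  rwa [Finset.sum_sub_distrib, Equiv.sum_comp σ c] at hle

theorem jac_eq_zero {k : Type} [Field k] {R : Fin 4 → MvPolynomial (Fin 4) k} (i : Fin 4)
    (hi : R i = 0) : jac k R = 0 :=
  Matrix.det_eq_zero_of_row_eq_zero i fun j => by simp [hi]

/-- first claim in the proof of Lemma 4.9: for the monomial valuation
`ν' = ν_0^α` at the origin with weights `α_i < 0`, one has
`ν'(Jac(R₁,R₂,R₃,R₄)) ≥ ν'(R₁) + ν'(R₂) + ν'(R₃) + ν'(R₄) - (α₀ + α₁ + α₂ + α₃)`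
for all `R₁,R₂,R₃,R₄ ∈ k[x,y,z,t]` (with `ν'(0) = +∞`). -/
theorem mvalO_jac_ge (k : Type) [Field k] [IsAlgClosed k] [CharZero k]
    (α : Fin 4 → ℝ) (hα : ∀ i, α i < 0)
    (R1 R2 R3 R4 : MvPolynomial (Fin 4) k) :
    mvalO k α R1 + mvalO k α R2 + mvalO k α R3 + mvalO k α R4
        - ((α 0 + α 1 + α 2 + α 3 : ℝ) : WithTop ℝ)
      ≤ mvalO k α (jac k ![R1, R2, R3, R4]) := by
  by_cases h : ∃ i, ![R1, R2, R3, R4] i = 0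
  · obtain ⟨i, hi⟩ := h
    rw [jac_eq_zero i hi, mvalO_zero]
    exact le_top
  · push Not at h
    obtain ⟨r₁, h₁⟩ := exists_mvalO_eq_coe α (h 0)
    obtain ⟨r₂, h₂⟩ := exists_mvalO_eq_coe α (h 1)
    obtain ⟨r₃, h₃⟩ := exists_mvalO_eq_coe α (h 2)
    obtain ⟨r₄, h₄⟩ := exists_mvalO_eq_coe α (h 3)
    have hdet : ((∑ i, ![r₁, r₂, r₃, r₄] i - ∑ j, α j : ℝ) : WithTop ℝ) ≤
        mvalO k α (jac k ![R1, R2, R3, R4]) := by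
      refine coe_le_mvalO_det fun i j => coe_le_mvalO_pderiv j ?_
      fin_cases i
      exacts [h₁.ge, h₂.ge, h₃.ge, h₄.ge]
    simp only [Fin.sum_univ_four] at hdet
    simp only [Matrix.cons_val] at h₁ h₂ h₃ h₄ hdet
    rw [h₁, h₂, h₃, h₄]
    exact_mod_cast hdet
end
end

section
/- For every valuation ν ∈ 𝒱₀ and all f1, f2 ∈ k[Q] that are algebraically independent over k, the parachute satisfies 0 < ∇(f1,f2) ≤ −ν(f1) − ν(f2); in particular ∇(f1,f2) is finite and strictly positive. -/
noncomputable section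

open MvPolynomial

section Jacobian

variable {k : Type} [Field k]

theorem qmk_surjective : Function.Surjective (qmk k) := Ideal.Quotient.mk_surjective

theorem qmk_eq_zero_iff {R : MvPolynomial (Fin 4) k} : qmk k R = 0 ↔ qpoly k - 1 ∣ R := by
  rw [qmk, Ideal.Quotient.eq_zero_iff_mem, Ideal.mem_span_singleton]

theorem jac_eq_sum (R u v w : MvPolynomial (Fin 4) k) :
    jac k ![R, u, v, w] = ∑ i, jac k ![R, X i, v, w] * pderiv i u := by
  simp [jac, Matrix.det_succ_row_zero, Fin.sum_univ_succ, Fin.succAbove, pderiv_X, Pi.single_apply]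
  ring

theorem jac_swap_left (R u v w : MvPolynomial (Fin 4) k) :
    jac k ![R, u, v, w] = -jac k ![R, v, u, w] := by
  simp [jac, Matrix.det_succ_row_zero, Fin.sum_univ_succ, Fin.succAbove]
  ring

theorem jac_swap_right (R u v w : MvPolynomial (Fin 4) k) :
    jac k ![R, u, v, w] = -jac k ![R, u, w, v] := by
  simp [jac, Matrix.det_succ_row_zero, Fin.sum_univ_succ, Fin.succAbove]
  ring

theorem jac_self_left (R u w : MvPolynomial (Fin 4) k) : jac k ![R, R, u, w] = 0 := by
  simp [jac, Matrix.det_succ_row_zero, Fin.sum_univ_succ, Fin.succAbove]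
  ring

theorem jac_self_mid (R u w : MvPolynomial (Fin 4) k) : jac k ![R, u, u, w] = 0 := by
  simp [jac, Matrix.det_succ_row_zero, Fin.sum_univ_succ, Fin.succAbove]
  ring

theorem jac_qpoly_X : jac k ![qpoly k, X 0, X 1, X 2] = -X 0 := by
  simp [jac, qpoly, Matrix.det_succ_row_zero, Fin.sum_univ_succ, Fin.succAbove, pderiv_X,
    Pi.single_apply]
  ring

/-- The derivation `u ↦ Jac(q, u, v, w)` of the polynomial ring. -/
def jacDer (v w : MvPolynomial (Fin 4) k) :
    Derivation k (MvPolynomial (Fin 4) k) (MvPolynomial (Fin 4) k) :=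
  ∑ i, jac k ![qpoly k, X i, v, w] • pderiv i

theorem jacDer_apply (u v w : MvPolynomial (Fin 4) k) :
    jacDer v w u = jac k ![qpoly k, u, v, w] := by
  rw [jac_eq_sum]
  simp [jacDer, Fin.sum_univ_succ]

theorem qmk_jacDer_eq_zero (v w u : MvPolynomial (Fin 4) k) (hu : qmk k u = 0) :
    qmk k (jacDer v w u) = 0 := by
  obtain ⟨s, rfl⟩ := qmk_eq_zero_iff.1 hu
  have hq : jacDer v w (qpoly k - 1) = 0 := by
    rw [map_sub, jacDer_apply, jac_self_left, Derivation.map_one_eq_zero, sub_zero]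
  rw [Derivation.leibniz, hq, smul_zero, add_zero, smul_eq_mul]
  exact qmk_eq_zero_iff.2 (dvd_mul_right _ _)

/-- The derivation of `k[Q]` induced by `u ↦ Jac(q, u, v, w)`. -/
def quadDer (v w : MvPolynomial (Fin 4) k) : Derivation k (QuadRing k) (QuadRing k) :=
  Derivation.liftOfSurjective (f := Ideal.Quotient.mkₐ k (Ideal.span {qpoly k - 1}))
    (Ideal.Quotient.mkₐ_surjective k _) (d := jacDer v w) (qmk_jacDer_eq_zero v w)

theorem quadDer_qmk (v w u : MvPolynomial (Fin 4) k) :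
    quadDer v w (qmk k u) = qmk k (jac k ![qpoly k, u, v, w]) := by
  rw [← jacDer_apply]
  exact Derivation.liftOfSurjective_apply (f := Ideal.Quotient.mkₐ k (Ideal.span {qpoly k - 1}))
    (Ideal.Quotient.mkₐ_surjective k _) (qmk_jacDer_eq_zero v w) u

theorem qmk_jac_congr {u v w v' w' : MvPolynomial (Fin 4) k} (hv : qmk k v = qmk k v')
    (hw : qmk k w = qmk k w') :
    qmk k (jac k ![qpoly k, u, v, w]) = qmk k (jac k ![qpoly k, u, v', w']) := by
  rw [jac_swap_left, map_neg, ← quadDer_qmk, hv, quadDer_qmk, ← map_neg, ← jac_swap_left,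
    jac_swap_right, jac_swap_left, neg_neg, ← quadDer_qmk, hw, quadDer_qmk,
    jac_swap_left, jac_swap_right, neg_neg]

theorem qmk_jac_eq_zero_of_forall_X {v w : MvPolynomial (Fin 4) k}
    (h : ∀ i, qmk k (jac k ![qpoly k, X i, v, w]) = 0) (u : MvPolynomial (Fin 4) k) :
    qmk k (jac k ![qpoly k, u, v, w]) = 0 := by
  rw [jac_eq_sum, map_sum]
  exact Finset.sum_eq_zero fun i _ => by rw [map_mul, h, zero_mul]

end Jacobian

section Domain

variable {k : Type} [Field k]

theorem prime_qpoly_sub_one : Prime (qpoly k - 1) := by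
  have hq : qpoly k - 1 = X 0 * X 3 + (-(X 1 * X 2) - 1) := by rw [qpoly]; ring
  rw [hq]
  refine Irreducible.prime (irreducible_mul_X_add _ _ _ (X_ne_zero _) (by simp) ?_ ?_)
  · intro h
    have h' := vars_sub_subset _ h
    rw [Finset.mem_union, vars_neg, vars_one] at h'
    have h'' := vars_mul _ _ (h'.resolve_right (by simp))
    simp at h''
  · rw [(X_prime (i := (0 : Fin 4)) (R := k)).irreducible.isRelPrime_iff_not_dvd]
    rintro ⟨s, hs⟩
    have := congrArg (eval 0) hs
    simp at this

instance : IsDomain (QuadRing k) :=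
  (Ideal.Quotient.isDomain_iff_prime _).2
    ((Ideal.span_singleton_prime prime_qpoly_sub_one.ne_zero).2 prime_qpoly_sub_one)

theorem qmk_X_zero_ne_zero : qmk k (X 0) ≠ 0 := by
  rw [Ne, qmk_eq_zero_iff]
  rintro ⟨s, hs⟩
  have := congrArg (eval ![1, 0, 0, 1]) hs
  simp [qpoly] at this

theorem qmk_relation :
    qmk k (X 0) * qmk k (X 3) - (1 + qmk k (X 1) * qmk k (X 2)) = 0 := by
  have h : qmk k (X 0 * X 3 - (1 + X 1 * X 2)) = 0 :=
    qmk_eq_zero_iff.2 (dvd_of_eq (by rw [qpoly]; ring))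
  simpa using h

theorem adjoin_qmk_X : Algebra.adjoin k (Set.range fun i : Fin 4 => qmk k (X i)) = ⊤ := by
  have h := congrArg (Subalgebra.map (Ideal.Quotient.mkₐ k (Ideal.span {qpoly k - 1})))
    (adjoin_range_X (σ := Fin 4) (R := k))
  rw [AlgHom.map_adjoin, Algebra.map_top,
    (AlgHom.range_eq_top _).2 (Ideal.Quotient.mkₐ_surjective k _), ← Set.range_comp] at h
  exact h

theorem isAlgebraic_of_mul_eq {A : Type*} [CommRing A] [Algebra k A] (B : Subalgebra k A)
    {a b t : A} (ha : a ∈ B) (hb : b ∈ B) (ha0 : a ≠ 0) (h : a * t = b) : IsAlgebraic B t := by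
  refine ⟨Polynomial.C ⟨a, ha⟩ * Polynomial.X - Polynomial.C ⟨b, hb⟩, fun h0 => ?_, ?_⟩
  · have := congrArg (fun p => Polynomial.coeff p 1) h0
    simp only [Polynomial.coeff_sub, Polynomial.coeff_C_mul, Polynomial.coeff_X_one, mul_one,
      Polynomial.coeff_C_succ, sub_zero, Polynomial.coeff_zero] at this
    exact ha0 (congrArg Subtype.val this)
  · rw [map_sub, map_mul, Polynomial.aeval_C, Polynomial.aeval_C, Polynomial.aeval_X]
    exact sub_eq_zero.2 h

theorem isAlgebraic_adjoin_three :
    Algebra.IsAlgebraic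
      (Algebra.adjoin k ({qmk k (X 0), qmk k (X 1), qmk k (X 2)} : Set (QuadRing k)))
      (QuadRing k) := by
  set s : Set (QuadRing k) := {qmk k (X 0), qmk k (X 1), qmk k (X 2)} with hs
  set B := Algebra.adjoin k s
  have hB : ∀ a ∈ s, a ∈ B := fun a ha => Algebra.subset_adjoin ha
  have h0 : qmk k (X 0) ∈ B := hB _ (by simp [hs])
  have h1 : qmk k (X 1) ∈ B := hB _ (by simp [hs])
  have h2 : qmk k (X 2) ∈ B := hB _ (by simp [hs])
  have halg : ∀ a (ha : a ∈ B), IsAlgebraic B a := fun a ha =>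
    isAlgebraic_algebraMap (⟨a, ha⟩ : B)
  have h3 : IsAlgebraic B (qmk k (X 3)) := by
    exact isAlgebraic_of_mul_eq B h0 (add_mem (one_mem B) (mul_mem h1 h2)) qmk_X_zero_ne_zero
      (sub_eq_zero.1 qmk_relation)
  have hle : Algebra.adjoin k (Set.range fun i : Fin 4 => qmk k (X i)) ≤
      (Subalgebra.algebraicClosure B (QuadRing k)).restrictScalars k := by
    rw [Algebra.adjoin_le_iff]
    rintro _ ⟨i, rfl⟩
    change IsAlgebraic B (qmk k (X i))
    fin_cases i
    exacts [halg _ h0, halg _ h1, halg _ h2, h3]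
  rw [adjoin_qmk_X] at hle
  exact ⟨fun a => hle (Algebra.mem_top (x := a))⟩

end Domain

section Derivation

variable {k A : Type*} [Field k] [CommRing A] [Algebra k A]

theorem Derivation.map_aeval_of_forall_eq_zero (B : Subalgebra k A) (D : Derivation k A A)
    (hD : ∀ b ∈ B, D b = 0) (a : A) (p : Polynomial B) :
    D (Polynomial.aeval a p) = Polynomial.aeval a p.derivative * D a := by
  induction p using Polynomial.induction_on' with
  | add p q hp hq => simp [hp, hq, add_mul]
  | monomial n b =>
    have hb : D (algebraMap B A b) = 0 := hD b b.2
    rw [Polynomial.aeval_monomial, Polynomial.derivative_monomial, Polynomial.aeval_monomial,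
      Derivation.leibniz, Derivation.leibniz_pow, hb]
    have hn : algebraMap B A (n : B) = n := _root_.map_natCast (algebraMap B A) n
    simp only [smul_eq_mul, nsmul_eq_mul, map_mul, hn]
    ring

theorem Derivation.eq_zero_of_isAlgebraic_adjoin [IsDomain A] [CharZero k] (s : Set A)
    [halg : Algebra.IsAlgebraic (Algebra.adjoin k s) A] (D : Derivation k A A)
    (hD : ∀ b ∈ s, D b = 0) : D = 0 := by
  have hB : ∀ b ∈ Algebra.adjoin k s, D b = 0 := fun b hb => by
    induction hb using Algebra.adjoin_induction with
    | mem x hx => exact hD x hx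
    | algebraMap r => exact D.map_algebraMap r
    | add x y _ _ hx hy => rw [map_add, hx, hy, add_zero]
    | mul x y _ _ hx hy => rw [Derivation.leibniz, hx, hy, smul_zero, smul_zero, add_zero]
  set B := Algebra.adjoin k s
  have : CharZero B := charZero_of_injective_algebraMap (algebraMap k B).injective
  ext a
  by_contra ha
  have key : ∀ (n : ℕ) (p : Polynomial B), p.natDegree = n → Polynomial.aeval a p = 0 → p = 0 := by
    intro n
    induction n with
    | zero =>
      intro p hp hpa
      rw [Polynomial.eq_C_of_natDegree_eq_zero hp] at hpa ⊢
      rw [Polynomial.aeval_C] at hpa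
      rw [(Subtype.ext hpa : p.coeff 0 = 0), map_zero]
    | succ n ih =>
      intro p hp hpa
      have h := D.map_aeval_of_forall_eq_zero B hB a p
      rw [hpa, map_zero] at h
      have h0 := ih p.derivative (by rw [Polynomial.natDegree_derivative, hp]; rfl)
        ((mul_eq_zero.1 h.symm).resolve_right ha)
      have := Polynomial.derivative_eq_zero.1 h0
      omega
  obtain ⟨p, hp, hpa⟩ := halg.isAlgebraic a
  exact hp (key _ p rfl hpa)

end Derivation

section Nonvanishing

variable {k : Type} [Field k]

theorem exists_isAlgebraic_adjoin {f1 f2 : QuadRing k}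
    (hind : AlgebraicIndependent k ![f1, f2]) :
    ∃ g, Algebra.IsAlgebraic (Algebra.adjoin k ({f1, f2, g} : Set (QuadRing k)))
      (QuadRing k) := by
  have hne : f1 ≠ f2 := fun h => by
    have := hind.injective (a₁ := 0) (a₂ := 1) (by simpa using h)
    simp at this
  have hrange : Set.range ![f1, f2] = {f1, f2} := by simp [Set.pair_comm]
  have hs : AlgebraicIndepOn k id ({f1, f2} : Set (QuadRing k)) := by
    rw [← hrange]; exact hind.to_subtype_range
  obtain ⟨t, hst, ht⟩ := exists_isTranscendenceBasis_superset hs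
  have h3 := isAlgebraic_adjoin_three (k := k)
  have hcard : Cardinal.mk t ≤ 3 := by
    rw [ht.cardinalMk_eq_trdeg]
    refine (Algebra.IsAlgebraic.trdeg_le_cardinalMk k (alg := h3)).trans ?_
    exact Cardinal.mk_insert_le.trans (by
      grw [Cardinal.mk_insert_le, Cardinal.mk_singleton]
      norm_num)
  have hfin : t.encard ≤ 3 := by
    rw [Set.encard, ENat.card]
    exact (OrderHomClass.mono Cardinal.toENat hcard).trans (by simp)
  have hdiff : (t \ {f1, f2}).encard ≤ 1 := by
    have h := Set.encard_sdiff_add_encard_of_subset hst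
    rw [Set.encard_pair hne] at h
    rw [← h] at hfin
    exact (ENat.add_le_add_iff_right (by simp)).1 (hfin.trans_eq (by norm_num : (3 : ℕ∞) = 1 + 2))
  have halg := ht.isAlgebraic
  rw [Subtype.range_coe] at halg
  obtain ⟨g, hg⟩ : ∃ g, t ⊆ {f1, f2, g} := by
    rcases (t \ {f1, f2}).eq_empty_or_nonempty with h | ⟨g, hg⟩
    · exact ⟨f1, fun x hx => by
        have := Set.sdiff_eq_empty.1 h hx
        simp only [Set.mem_insert_iff, Set.mem_singleton_iff] at this ⊢
        tauto⟩
    · refine ⟨g, fun x hx => ?_⟩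
      by_contra hx'
      simp only [Set.mem_insert_iff, Set.mem_singleton_iff, not_or] at hx'
      exact hx'.2.2 (Set.encard_le_one_iff.1 hdiff x g ⟨hx, by simp [hx'.1, hx'.2.1]⟩ hg)
  refine ⟨g, ⟨fun a => ?_⟩⟩
  have hle := Algebra.adjoin_mono (R := k) hg
  obtain ⟨p, hp, hpa⟩ := halg.isAlgebraic a
  refine ⟨p.map (Subalgebra.inclusion hle).toRingHom, ?_, ?_⟩
  · rwa [Ne, Polynomial.map_eq_zero_iff (Subalgebra.inclusion_injective hle)]
  · rw [← hpa, Polynomial.aeval_def, Polynomial.eval₂_map]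
    rfl

theorem exists_qmk_jac_ne_zero [CharZero k] {R1 R2 : MvPolynomial (Fin 4) k}
    (hind : AlgebraicIndependent k ![qmk k R1, qmk k R2]) :
    ∃ i, qmk k (jac k ![qpoly k, X i, R1, R2]) ≠ 0 := by
  by_contra! hX
  obtain ⟨g, halg⟩ := exists_isAlgebraic_adjoin hind
  obtain ⟨G, rfl⟩ := qmk_surjective g
  obtain ⟨T, hT⟩ : ∃ T : MvPolynomial (Fin 4) k → MvPolynomial (Fin 4) k →
      MvPolynomial (Fin 4) k → QuadRing k,
      ∀ u v w, T u v w = qmk k (jac k ![qpoly k, u, v, w]) := ⟨_, fun _ _ _ => rfl⟩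
  have swapL : ∀ u v w, T u v w = -T v u w := fun u v w => by
    rw [hT, hT, jac_swap_left, map_neg]
  have swapR : ∀ u v w, T u v w = -T u w v := fun u v w => by
    rw [hT, hT, jac_swap_right, map_neg]
  have self : ∀ u w, T u u w = 0 := fun u w => by
    rw [hT, jac_self_mid, map_zero]
  have key : ∀ v w, T R1 v w = 0 → T R2 v w = 0 → T G v w = 0 → ∀ u, T u v w = 0 := by
    intro v w h1 h2 h3 u
    have hD : quadDer v w = 0 := by
      refine Derivation.eq_zero_of_isAlgebraic_adjoin {qmk k R1, qmk k R2, qmk k G} _ ?_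
      rintro b (rfl | rfl | rfl) <;> rw [quadDer_qmk, ← hT] <;> assumption
    rw [hT, ← quadDer_qmk, hD, Derivation.zero_apply]
  have h12 : ∀ u, T u R1 R2 = 0 := fun u => by
    rw [hT, qmk_jac_eq_zero_of_forall_X hX]
  have last : ∀ u w, T u w u = 0 := fun u w => by rw [swapR, self, neg_zero]
  have symm : ∀ v w, (∀ u, T u v w = 0) → ∀ u, T u w v = 0 := fun v w h u => by
    rw [swapR, h, neg_zero]
  have pre : ∀ v w, (∀ u, T u v w = 0) → ∀ u, T v w u = 0 := fun v w h u => by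
    rw [swapR, swapL, h, neg_zero, neg_zero]
  have h1G := key R1 G (self _ _) (pre _ _ (symm _ _ h12) _) (last _ _)
  have h2G := key R2 G (pre _ _ h12 _) (self _ _) (last _ _)
  have h1 : ∀ v u, T u R1 v = 0 := fun v =>
    key _ _ (self _ _) (pre _ _ (symm _ _ h12) _) (pre _ _ (symm _ _ h1G) _)
  have h2 : ∀ v u, T u R2 v = 0 := fun v =>
    key _ _ (pre _ _ h12 _) (self _ _) (pre _ _ (symm _ _ h2G) _)
  have hG : ∀ v u, T u G v = 0 := fun v =>
    key _ _ (pre _ _ h1G _) (pre _ _ h2G _) (self _ _)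
  have hall : T (X 0) (X 1) (X 2) = 0 :=
    key _ _ (pre _ _ (h1 _) _) (pre _ _ (h2 _) _) (pre _ _ (hG _) _) _
  rw [hT, jac_qpoly_X, map_neg, neg_eq_zero] at hall
  exact qmk_X_zero_ne_zero hall

end Nonvanishing

section Weights

variable {k : Type} [Field k] {α : Fin 4 → ℝ}

/-- Every exponent occurring in `R` has `α`-weight at least `c`. -/
def WeightGE (α : Fin 4 → ℝ) (c : ℝ) (R : MvPolynomial (Fin 4) k) : Prop :=
  ∀ I, R.coeff I ≠ 0 → c ≤ ∑ i, α i * (I i : ℝ)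

theorem WeightGE.mono {c d : ℝ} {R : MvPolynomial (Fin 4) k} (h : WeightGE α c R) (hd : d ≤ c) :
    WeightGE α d R := fun I hI => hd.trans (h I hI)

theorem weightGE_zero (c : ℝ) : WeightGE α c (0 : MvPolynomial (Fin 4) k) :=
  fun I hI => absurd (coeff_zero I) hI

theorem weightGE_one : WeightGE α 0 (1 : MvPolynomial (Fin 4) k) := fun I hI => by
  have : I = 0 := by
    by_contra h
    exact hI (by rw [coeff_one, if_neg (Ne.symm h)])
  simp [this]

theorem weightGE_C {c : ℝ} (hc : c ≤ 0) (a : k) : WeightGE α c (C a) := fun I hI => by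
  have : I = 0 := by
    by_contra h
    exact hI (by rw [coeff_C, if_neg (Ne.symm h)])
  simp [this, hc]

theorem weightGE_X (i : Fin 4) : WeightGE α (α i) (X i : MvPolynomial (Fin 4) k) := fun I hI => by
  have : Finsupp.single i 1 = I := by
    by_contra h
    exact hI (by rw [coeff_X, if_neg h])
  simp [← this, Finsupp.single_apply]

theorem WeightGE.add {c : ℝ} {R S : MvPolynomial (Fin 4) k} (hR : WeightGE α c R)
    (hS : WeightGE α c S) : WeightGE α c (R + S) := fun I hI => by
  by_cases h : R.coeff I = 0
  · exact hS I fun h' => hI (by rw [coeff_add, h, h', add_zero])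
  · exact hR I h

theorem WeightGE.neg {c : ℝ} {R : MvPolynomial (Fin 4) k} (hR : WeightGE α c R) :
    WeightGE α c (-R) := fun I hI => hR I fun h => hI (by rw [coeff_neg, h, neg_zero])

theorem WeightGE.sub {c : ℝ} {R S : MvPolynomial (Fin 4) k} (hR : WeightGE α c R)
    (hS : WeightGE α c S) : WeightGE α c (R - S) := by
  rw [sub_eq_add_neg]
  exact hR.add hS.neg

theorem WeightGE.mul {c d : ℝ} {R S : MvPolynomial (Fin 4) k} (hR : WeightGE α c R)
    (hS : WeightGE α d S) : WeightGE α (c + d) (R * S) := fun I hI => by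
  rw [coeff_mul] at hI
  obtain ⟨⟨J, K⟩, hJK, hne⟩ := Finset.exists_ne_zero_of_sum_ne_zero hI
  rw [← Finset.HasAntidiagonal.mem_antidiagonal.1 hJK]
  refine (add_le_add (hR J (left_ne_zero_of_mul hne)) (hS K (right_ne_zero_of_mul hne))).trans_eq ?_
  rw [← Finset.sum_add_distrib]
  exact Finset.sum_congr rfl fun i _ => by simp [mul_add]

theorem weightGE_prod {ι : Type*} (s : Finset ι) (c : ι → ℝ) (R : ι → MvPolynomial (Fin 4) k)
    (h : ∀ i ∈ s, WeightGE α (c i) (R i)) : WeightGE α (∑ i ∈ s, c i) (∏ i ∈ s, R i) := by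
  classical
  induction s using Finset.induction_on with
  | empty => simpa using weightGE_one
  | insert a s ha ih =>
    rw [Finset.sum_insert ha, Finset.prod_insert ha]
    exact (h a (by simp)).mul (ih fun i hi => h i (by simp [hi]))

theorem weightGE_sum {ι : Type*} (s : Finset ι) (c : ℝ) (R : ι → MvPolynomial (Fin 4) k)
    (h : ∀ i ∈ s, WeightGE α c (R i)) : WeightGE α c (∑ i ∈ s, R i) :=
  Finset.sum_induction _ _ (fun _ _ => WeightGE.add) (weightGE_zero c) h

theorem WeightGE.pderiv {c : ℝ} {R : MvPolynomial (Fin 4) k} (hR : WeightGE α c R) (i : Fin 4) :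
    WeightGE α (c - α i) (pderiv i R) := fun I hI => by
  rw [coeff_pderiv] at hI
  have h := hR _ (left_ne_zero_of_mul hI)
  have hsum : ∑ j, α j * ((I + Finsupp.single i 1 : Fin 4 →₀ ℕ) j : ℝ) =
      ∑ j, α j * (I j : ℝ) + α i := by
    simp [mul_add, Finset.sum_add_distrib, Finsupp.single_apply]
  linarith

theorem weightGE_jac (c : Fin 4 → ℝ) (R : Fin 4 → MvPolynomial (Fin 4) k)
    (h : ∀ i, WeightGE α (c i) (R i)) : WeightGE α (∑ i, c i - ∑ i, α i) (jac k R) := by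
  rw [jac, Matrix.det_apply']
  refine weightGE_sum _ _ _ fun σ _ => ?_
  have hσ : WeightGE α (∑ i, c i - ∑ i, α i)
      (∏ j, (Matrix.of fun i j : Fin 4 => MvPolynomial.pderiv j (R i)) (σ j) j) := by
    rw [← Equiv.sum_comp σ c, ← Finset.sum_sub_distrib]
    exact weightGE_prod _ _ _ fun j _ => (h (σ j)).pderiv j
  rcases Int.units_eq_one_or (Equiv.Perm.sign σ) with hs | hs
  · simpa [hs] using hσ
  · simpa [hs] using hσ.neg

/-- The translation `R ↦ R(x + p)` of the polynomial ring. -/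
def translatePoly (p : Fin 4 → k) : MvPolynomial (Fin 4) k →ₐ[k] MvPolynomial (Fin 4) k :=
  aeval fun i => X i + C (p i)

theorem translate_injective (p : Fin 4 → k) : Function.Injective (translatePoly p) := by
  have h : (translatePoly (-p)).comp (translatePoly p) = AlgHom.id k _ := by
    ext i
    simp [translatePoly, algHom_C, algebraMap_eq]
  exact Function.LeftInverse.injective (g := translatePoly (-p)) fun R => DFunLike.congr_fun h R

theorem pderiv_translate (p : Fin 4 → k) (i : Fin 4) (R : MvPolynomial (Fin 4) k) :
    pderiv i (translatePoly p R) = translatePoly p (pderiv i R) := by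
  induction R using MvPolynomial.induction_on with
  | C a => simp [translatePoly, algebraMap_eq]
  | add R S hR hS => simp only [map_add, hR, hS]
  | mul_X R j hR =>
    have hX : pderiv i (translatePoly p (X j)) = translatePoly p (pderiv i (X j)) := by
      by_cases hij : j = i <;> simp [translatePoly, pderiv_X, hij]
    rw [map_mul, pderiv_mul, pderiv_mul, map_add, map_mul, map_mul, hR, hX]

theorem translate_jac (p : Fin 4 → k) (R : Fin 4 → MvPolynomial (Fin 4) k) :
    translatePoly p (jac k R) = jac k fun i => translatePoly p (R i) := by
  rw [jac, AlgHom.map_det, jac]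
  congr 1
  ext1 i j
  exact (pderiv_translate p j (R i)).symm

theorem weightGE_translate_X (hα : ∀ i, α i < 0) (p : Fin 4 → k) (i : Fin 4) :
    WeightGE α (α i) (translatePoly p (X i)) := by
  rw [translatePoly, aeval_X]
  exact (weightGE_X i).add (weightGE_C (hα i).le _)

theorem weightGE_translate_qpoly (hα : ∀ i, α i < 0) (hsum : α 0 + α 3 = α 1 + α 2)
    (p : Fin 4 → k) : WeightGE α (α 0 + α 3) (translatePoly p (qpoly k)) := by
  rw [qpoly, map_sub, map_mul, map_mul]
  have h := weightGE_translate_X hα p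
  exact ((h 0).mul (h 3)).sub (hsum ▸ (h 1).mul (h 2))

theorem coe_le_mvalP_iff {p : Fin 4 → k} {c : ℝ} {R : MvPolynomial (Fin 4) k} :
    (c : WithTop ℝ) ≤ mvalP k p α R ↔ WeightGE α c (translatePoly p R) := by
  simp only [mvalP, Finset.le_inf_iff, WithTop.coe_le_coe, mem_support_iff]
  rfl

theorem mvalP_nonpos (hα : ∀ i, α i < 0) (p : Fin 4 → k) {R : MvPolynomial (Fin 4) k}
    (hR : R ≠ 0) : mvalP k p α R ≤ 0 := by
  obtain ⟨I, hI⟩ := support_nonempty.2 ((map_ne_zero_iff _ (translate_injective p)).2 hR)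
  refine (Finset.inf_le hI).trans ?_
  rw [← WithTop.coe_zero, WithTop.coe_le_coe]
  exact Finset.sum_nonpos fun i _ => mul_nonpos_of_nonpos_of_nonneg (hα i).le (Nat.cast_nonneg _)

theorem weightGE_translate_jac {ε a b : ℝ} (hα : ∀ i, α i ≤ -(4 * ε)) (hε : 0 < ε)
    (hsum : α 0 + α 3 = α 1 + α 2) {p : Fin 4 → k} {R S : MvPolynomial (Fin 4) k}
    (hR : WeightGE α (a - ε) (translatePoly p R)) (hS : WeightGE α (b - ε) (translatePoly p S))
    (i : Fin 4) : WeightGE α (a + b + 2 * ε) (translatePoly p (jac k ![qpoly k, X i, R, S])) := by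
  have hneg : ∀ i, α i < 0 := fun i => (hα i).trans_lt (by linarith)
  rw [translate_jac]
  refine (weightGE_jac ![α 0 + α 3, α i, a - ε, b - ε] _ fun j => ?_).mono ?_
  · fin_cases j
    exacts [weightGE_translate_qpoly hneg hsum p, weightGE_translate_X hneg p i, hR, hS]
  · have h0 := hα 0
    have h1 := hα 1
    have h2 := hα 2
    have h3 := hα 3
    simp only [Fin.sum_univ_four]
    fin_cases i <;> simp <;> linarith

end Weights

section Supremum

variable {k : Type} [Field k] {α : Fin 4 → ℝ} {p : Fin 4 → k}

theorem isLUB_nuSup (p : Fin 4 → k) (α : Fin 4 → ℝ) (f : QuadRing k) :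
    IsLUB {v : WithTop ℝ | ∃ R, qmk k R = f ∧ mvalP k p α R = v} (nuSup k p α f) :=
  WithTop.isLUB_sSup' (let ⟨R, hR⟩ := qmk_surjective f; ⟨_, R, hR, rfl⟩)

theorem mvalP_le_nuSup (R : MvPolynomial (Fin 4) k) :
    mvalP k p α R ≤ nuSup k p α (qmk k R) :=
  (isLUB_nuSup p α _).1 ⟨R, rfl, rfl⟩

theorem nuSup_nonpos (hα : ∀ i, α i < 0) {f : QuadRing k} (hf : f ≠ 0) :
    nuSup k p α f ≤ 0 := by
  refine (isLUB_nuSup p α f).2 ?_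
  rintro _ ⟨R, rfl, rfl⟩
  exact mvalP_nonpos hα p fun h => hf (by rw [h, map_zero])

theorem exists_nuSup_eq_coe (hα : ∀ i, α i < 0) {f : QuadRing k} (hf : f ≠ 0) :
    ∃ a : ℝ, nuSup k p α f = a := by
  have h := nuSup_nonpos (p := p) hα hf
  exact ⟨_, (WithTop.coe_untop _ (ne_top_of_le_ne_top WithTop.zero_ne_top h)).symm⟩

theorem exists_weightGE_translate {f : QuadRing k} {a ε : ℝ} (h : nuSup k p α f = a)
    (hε : 0 < ε) : ∃ R, qmk k R = f ∧ WeightGE α (a - ε) (translatePoly p R) := by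
  have hlt : ((a - ε : ℝ) : WithTop ℝ) < nuSup k p α f := by
    rw [h, WithTop.coe_lt_coe]
    linarith
  obtain ⟨_, ⟨R, hR, rfl⟩, hlt', -⟩ := (isLUB_nuSup p α f).exists_between hlt
  exact ⟨R, hR, coe_le_mvalP_iff.1 hlt'.le⟩

end Supremum

/-- finiteness and bounds for the parachute: for every `ν ∈ 𝒱₀` and all
algebraically independent `f₁, f₂ ∈ k[Q]`, the values `ν(f₁) = a`, `ν(f₂) = b` and
`min(ν(j(x,f₁,f₂)), ν(j(y,f₁,f₂)), ν(j(z,f₁,f₂)), ν(j(t,f₁,f₂))) = c` are finite real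
numbers and the parachute `∇(f₁,f₂) = c - a - b` satisfies `0 < ∇(f₁,f₂) ≤ -a - b`. -/
theorem parachute_pos_le (k : Type) [Field k] [IsAlgClosed k] [CharZero k]
    (ν : QuadRing k → WithTop ℝ) (hν : ν ∈ V0 k)
    (f1 f2 : QuadRing k)
    (hind : AlgebraicIndependent k ![f1, f2])
    (R1 R2 : MvPolynomial (Fin 4) k)
    (h1 : qmk k R1 = f1) (h2 : qmk k R2 = f2) :
    ∃ a b c : ℝ, ν f1 = (a : WithTop ℝ) ∧ ν f2 = (b : WithTop ℝ) ∧
      min (min (ν (qmk k (jac k ![qpoly k, X 0, R1, R2])))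
               (ν (qmk k (jac k ![qpoly k, X 1, R1, R2]))))
          (min (ν (qmk k (jac k ![qpoly k, X 2, R1, R2])))
               (ν (qmk k (jac k ![qpoly k, X 3, R1, R2])))) = (c : WithTop ℝ) ∧
      0 < c - a - b ∧ c - a - b ≤ -a - b := by
  obtain ⟨p, α, hα, hsum, rfl⟩ := hν
  subst h1 h2
  obtain ⟨a, ha⟩ := exists_nuSup_eq_coe (p := p) hα (hind.ne_zero 0)
  obtain ⟨b, hb⟩ := exists_nuSup_eq_coe (p := p) hα (hind.ne_zero 1)
  simp only [Matrix.cons_val_zero, Matrix.cons_val_one] at ha hb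
  obtain ⟨ε, hε, hαε⟩ : ∃ ε > 0, ∀ i, α i ≤ -(4 * ε) := by
    obtain ⟨i, hi⟩ := Finite.exists_max α
    exact ⟨-α i / 4, by linarith [hα i], fun j => by linarith [hi j]⟩
  obtain ⟨S1, hS1, hw1⟩ := exists_weightGE_translate ha hε
  obtain ⟨S2, hS2, hw2⟩ := exists_weightGE_translate hb hε
  obtain ⟨N, hN⟩ : ∃ N : Fin 4 → WithTop ℝ,
      ∀ i, nuSup k p α (qmk k (jac k ![qpoly k, X i, R1, R2])) = N i := ⟨_, fun _ => rfl⟩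
  have hlow : ∀ i, ((a + b + 2 * ε : ℝ) : WithTop ℝ) ≤ N i := fun i => by
    rw [← hN, ← qmk_jac_congr hS1 hS2]
    exact (coe_le_mvalP_iff.2 (weightGE_translate_jac hαε hε hsum hw1 hw2 i)).trans
      (mvalP_le_nuSup _)
  obtain ⟨i, hi⟩ := exists_qmk_jac_ne_zero hind
  have hi0 : N i ≤ 0 := hN i ▸ nuSup_nonpos hα hi
  simp only [hN]
  set m := min (min (N 0) (N 1)) (min (N 2) (N 3)) with hm
  have hm0 : m ≤ 0 := by
    refine le_trans ?_ hi0
    fin_cases i <;> simp [hm]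
  have hml : ((a + b + 2 * ε : ℝ) : WithTop ℝ) ≤ m :=
    le_min (le_min (hlow 0) (hlow 1)) (le_min (hlow 2) (hlow 3))
  clear_value m
  lift m to ℝ using ne_top_of_le_ne_top WithTop.zero_ne_top hm0
  rw [← WithTop.coe_zero, WithTop.coe_le_coe] at hm0
  rw [WithTop.coe_le_coe] at hml
  exact ⟨a, b, m, ha, hb, rfl, by linarith, by linarith⟩
end
end
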